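/- Let L be a number field that is Galois over ℚ, and let I be a nonzero ideal of O_L such that σ(I) = I for every σ ∈ Gal(L/ℚ). Then I is generated by a rational integer (i.e. I = n·O_L for some positive integer n) if and only if for every rational prime q the degree [L:ℚ] divides the q-adic valuation of the absolute norm of I. -/

import Mathlib

open NumberField

theorem map_span_absNorm_eq_pow
    (L : Type*) [Field L] [NumberField L] [IsGalois ℚ L]
    (I : Ideal (𝓞 L)) (hI : I ≠ 0)
    (hstab : ∀ σ : L ≃ₐ[ℚ] L, Ideal.map (galRestrict ℤ ℚ L (𝓞 L) σ) I = I) :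
    Ideal.span {((Ideal.absNorm I : ℕ) : 𝓞 L)} = I ^ Module.finrank ℚ L := by
  have hle : Ideal.span {((Ideal.absNorm I : ℕ) : 𝓞 L)} ≤ I ^ Module.finrank ℚ L := by
    have h1 : Ideal.span {((Ideal.absNorm I : ℕ) : 𝓞 L)} =
        Ideal.map (algebraMap ℤ (𝓞 L)) (Ideal.relNorm ℤ I) := by
      rw [Ideal.relNorm_int, Ideal.map_span]
      simp
    rw [h1, Ideal.map_relNorm, Ideal.span_le]
    rintro _ ⟨x, hx, rfl⟩
    have h2 : algebraMap ℤ (𝓞 L) (Algebra.intNorm ℤ (𝓞 L) x) =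
        ∏ σ : L ≃ₐ[ℚ] L, galRestrict ℤ ℚ L (𝓞 L) σ x := by
      rw [prod_galRestrict_eq_norm]
      congr 1
      apply (algebraMap ℤ ℚ).injective_int
      rw [Algebra.algebraMap_intNorm (K := ℚ) (L := L)]
      exact (IsIntegralClosure.algebraMap_mk' ..).symm
    simp only [Function.comp, SetLike.mem_coe]
    rw [h2, ← IsGalois.card_aut_eq_finrank ℚ L, Nat.card_eq_fintype_card,
      ← Finset.card_univ, ← Finset.prod_const]
    refine Ideal.prod_mem_prod fun σ _ => ?_
    have := Ideal.mem_map_of_mem (galRestrict ℤ ℚ L (𝓞 L) σ) hx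
    rwa [hstab] at this
  obtain ⟨J, hJ⟩ := Ideal.dvd_iff_le.mpr hle
  have hN : Ideal.absNorm I ≠ 0 := by
    rwa [Ne, Ideal.absNorm_eq_zero_iff]
  have h3 := congrArg Ideal.absNorm hJ
  rw [Ideal.absNorm_span_natCast, map_mul, map_pow, RingOfIntegers.rank] at h3
  have h4 : Ideal.absNorm J = 1 :=
    Nat.eq_of_mul_eq_mul_left (pow_pos (Nat.pos_of_ne_zero hN) (Module.finrank ℚ L))
      (h3.symm.trans (mul_one _).symm)
  rw [Ideal.absNorm_eq_one_iff] at h4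
  rw [hJ, h4, Ideal.mul_top]

/-- a nonzero Galois-stable ideal `I` of the ring of integers of a
Galois number field `L/ℚ` is generated by a (positive) rational integer if and
only if `[L:ℚ]` divides `v_q(N(I))` for every rational prime `q`. -/
theorem galois_stable_ideal_rational_iff
    (L : Type*) [Field L] [NumberField L] [IsGalois ℚ L]
    (I : Ideal (𝓞 L)) (hI : I ≠ 0)
    (hstab : ∀ σ : L ≃ₐ[ℚ] L, Ideal.map (galRestrict ℤ ℚ L (𝓞 L) σ) I = I) :
    (∃ n : ℕ, 0 < n ∧ I = Ideal.span {(n : 𝓞 L)}) ↔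
      ∀ q : ℕ, q.Prime →
        Module.finrank ℚ L ∣ (Ideal.absNorm I).factorization q := by
  constructor
  · rintro ⟨n, -, rfl⟩ q -
    rw [Ideal.absNorm_span_natCast, RingOfIntegers.rank, Nat.factorization_pow]
    simp
  · intro h
    have hd : Module.finrank ℚ L ≠ 0 := Module.finrank_pos.ne'
    have hN : Ideal.absNorm I ≠ 0 := by
      rwa [Ne, Ideal.absNorm_eq_zero_iff]
    obtain ⟨n, hn⟩ : ∃ n : ℕ, Ideal.absNorm I = n ^ Module.finrank ℚ L := by
      refine ⟨(Ideal.absNorm I).factorization.prod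
        fun p k => p ^ (k / Module.finrank ℚ L), ?_⟩
      conv_lhs => rw [← Nat.prod_factorization_pow_eq_self hN]
      rw [Finsupp.prod, Finsupp.prod, ← Finset.prod_pow]
      refine Finset.prod_congr rfl fun p hp => ?_
      rw [← pow_mul, Nat.div_mul_cancel (h p (Nat.prime_of_mem_primeFactors hp))]
    have hn0 : n ≠ 0 := by
      rintro rfl
      exact hN (by rw [hn, zero_pow hd])
    refine ⟨n, Nat.pos_of_ne_zero hn0, ?_⟩
    have key := map_span_absNorm_eq_pow L I hI hstab
    rw [hn, Nat.cast_pow, ← Ideal.span_singleton_pow] at key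
    exact (pow_left_inj hd).mp key.symm
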